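/- For every prime p, there exists a bijection from the disjoint union ({0} × (ℤ_p∖{0})) ∪ ({1} × (ℤ_p∖{0})) (a subset of ℚ_p²) onto ℤ_p∖{0} (a subset of ℚ_p) whose graph, viewed as a subset of ℚ_p³ (encoded as Set (Fin 3 → ℚ_p)), is ∅-definable in the first-order language of rings. -/

import Mathlib

open FirstOrder

noncomputable instance (p : ℕ) [Fact p.Prime] : FirstOrder.Ring.CompatibleRing ℚ_[p] :=
  FirstOrder.Ring.compatibleRingOfRing _

section Definability

open Set FirstOrder.Ring

variable {R : Type*} [CommRing R] [CompatibleRing R]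

theorem Set.definable_freeCommRing_lift_eq {α : Type*} (P Q : FreeCommRing α) :
    (∅ : Set R).Definable Language.ring
      {v : α → R | FreeCommRing.lift v P = FreeCommRing.lift v Q} :=
  empty_definable_iff.2
    ⟨(termOfFreeCommRing P).equal (termOfFreeCommRing Q), by ext; simp⟩

theorem Set.Definable₁.definable_apply_mem {L : Language} {M : Type*} [L.Structure M] {A : Set M}
    {s : Set M} (hs : A.Definable₁ L s) {α : Type*} (a : α) :
    A.Definable L {v : α → M | v a ∈ s} :=
  Definable.preimage_comp (fun _ : Fin 1 => a) hs

/-- If `D` and `E` are both parametrized bijectively by `ι × S`, through a tagged monomial map and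
a monomial map respectively, then `D` and `E` are in definable bijection. -/
theorem exists_bijOn_definable_of_monomial {ι : Type*} [Finite ι] {S E : Set R} {D : Set (R × R)}
    (hS : (∅ : Set R).Definable₁ Language.ring S) (τ α β m l : ι → ℕ)
    (hD : BijOn (fun q : ι × R => ((τ q.1 : R), (α q.1 : R) * q.2 ^ m q.1)) (univ ×ˢ S) D)
    (hE : BijOn (fun q : ι × R => (β q.1 : R) * q.2 ^ l q.1) (univ ×ˢ S) E) :
    ∃ f : R × R → R, BijOn f D E ∧
      (∅ : Set R).Definable Language.ring
        {v : Fin 3 → R | (v 0, v 1) ∈ D ∧ f (v 0, v 1) = v 2} := by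
  cases isEmpty_or_nonempty ι
  · have hD0 : D = ∅ := by simpa [eq_empty_of_isEmpty] using hD.image_eq.symm
    have hE0 : E = ∅ := by simpa [eq_empty_of_isEmpty] using hE.image_eq.symm
    refine ⟨fun _ => 0, by simp [hD0, hE0], ?_⟩
    simp [hD0, definable_empty]
  have : Nonempty (ι × R) := inferInstance
  set φ := fun q : ι × R => ((τ q.1 : R), (α q.1 : R) * q.2 ^ m q.1)
  set ψ := fun q : ι × R => (β q.1 : R) * q.2 ^ l q.1
  refine ⟨ψ ∘ Function.invFunOn φ (univ ×ˢ S),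
    hE.comp (hD.invOn_invFunOn.symm.bijOn hD.surjOn.mapsTo_invFunOn hD.mapsTo), ?_⟩
  have key : {v : Fin 3 → R | (v 0, v 1) ∈ D ∧
      (ψ ∘ Function.invFunOn φ (univ ×ˢ S)) (v 0, v 1) = v 2} =
      ⋃ i, {v : Fin 3 → R | ∃ u : Fin 1 → R, Sum.elim v u ∈
        {w : Fin 3 ⊕ Fin 1 → R | w (.inr 0) ∈ S} ∩
        ({w | w (.inl 0) = τ i} ∩ {w | w (.inl 1) = α i * w (.inr 0) ^ m i} ∩
          {w | w (.inl 2) = β i * w (.inr 0) ^ l i})} := by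
    ext v
    simp only [mem_iUnion]
    constructor
    · rintro ⟨hv, hf⟩
      obtain ⟨⟨i, s⟩, ⟨-, hs⟩, hq⟩ := hD.surjOn hv
      have hinv := hD.injOn.leftInvOn_invFunOn (show (i, s) ∈ univ ×ˢ S from ⟨trivial, hs⟩)
      rw [← hq, Function.comp_apply, hinv] at hf
      have h := Prod.ext_iff.1 hq
      exact ⟨i, fun _ => s, hs, ⟨h.1.symm, h.2.symm⟩, hf.symm⟩
    · rintro ⟨i, u, hs, ⟨h0, h1⟩, h2⟩
      have hmem : (i, u 0) ∈ univ ×ˢ S := ⟨trivial, hs⟩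
      have hq : φ (i, u 0) = (v 0, v 1) := Prod.ext h0.symm h1.symm
      have hinv := hD.injOn.leftInvOn_invFunOn hmem
      refine ⟨hq ▸ hD.mapsTo hmem, ?_⟩
      rw [← hq, Function.comp_apply, hinv]
      exact h2.symm
  rw [key]
  refine definable_iUnion_of_finite fun i => Definable.exists_of_finite ?_
  have hx : ∀ (j : Fin 3 ⊕ Fin 1) (a n : ℕ), (∅ : Set R).Definable Language.ring
      {w : Fin 3 ⊕ Fin 1 → R | w j = a * w (.inr 0) ^ n} := fun j a n => by
    simpa using definable_freeCommRing_lift_eq (R := R) (.of j) (a * .of (.inr 0) ^ n)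
  refine (hS.definable_apply_mem _).inter (((?_ : Definable _ _ _).inter (hx _ _ _)).inter (hx _ _ _))
  simpa using hx (.inl 0) (τ i) 0

end Definability

theorem Set.BijOn.image_of_semiconj {α β α' β' : Type*} {f : α → β} {f' : α' → β'} {a : α → α'}
    {b : β → β'} {s : Set α} {t : Set β} (hf : Set.BijOn f s t) (hb : Set.InjOn b t)
    (h : ∀ x ∈ s, f' (a x) = b (f x)) : Set.BijOn f' (a '' s) (b '' t) := by
  refine ⟨?_, ?_, ?_⟩
  · rintro _ ⟨x, hx, rfl⟩
    exact ⟨f x, hf.mapsTo hx, (h x hx).symm⟩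
  · rintro _ ⟨x, hx, rfl⟩ _ ⟨y, hy, rfl⟩ hxy
    rw [h x hx, h y hy] at hxy
    rw [hf.injOn hx hy (hb (hf.mapsTo hx) (hf.mapsTo hy) hxy)]
  · rintro _ ⟨y, hy, rfl⟩
    obtain ⟨x, hx, rfl⟩ := hf.surjOn hy
    exact ⟨a x, ⟨x, hx, rfl⟩, h x hx⟩

theorem Set.BijOn.sigma_tag {T α β : Type*} {ρ : T → Type*} {s : Set α} {u : Set β}
    {g : ∀ t, ρ t × α → β} (h : ∀ t, Set.BijOn (g t) (Set.univ ×ˢ s) u) :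
    Set.BijOn (fun q : (Σ t, ρ t) × α => (q.1.1, g q.1.1 (q.1.2, q.2)))
      (Set.univ ×ˢ s) (Set.univ ×ˢ u) := by
  refine ⟨?_, ?_, ?_⟩
  · rintro ⟨⟨t, r⟩, x⟩ ⟨-, hx⟩
    exact ⟨trivial, (h t).mapsTo (Set.mk_mem_prod (Set.mem_univ r) hx)⟩
  · rintro ⟨⟨t, r⟩, x⟩ ⟨-, hx⟩ ⟨⟨t', r'⟩, x'⟩ ⟨-, hx'⟩ heq
    obtain ⟨ht, heq⟩ := Prod.mk.inj heq
    obtain rfl : t = t' := ht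
    obtain ⟨rfl, rfl⟩ := Prod.mk.inj ((h t).injOn (Set.mk_mem_prod (Set.mem_univ r) hx)
      (Set.mk_mem_prod (Set.mem_univ r') hx') heq)
    rfl
  · rintro ⟨t, y⟩ ⟨-, hy⟩
    obtain ⟨⟨r, x⟩, ⟨-, hx⟩, rfl⟩ := (h t).surjOn hy
    exact ⟨(⟨t, r⟩, x), ⟨trivial, hx⟩, rfl⟩

theorem Set.BijOn.comp_equiv_fst {ι κ α β : Type*} {s : Set α} {u : Set β} {g : κ × α → β}
    (h : Set.BijOn g (Set.univ ×ˢ s) u) (e : ι ≃ κ) :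
    Set.BijOn (fun q : ι × α => g (e q.1, q.2)) (Set.univ ×ˢ s) u :=
  h.comp ((Set.bijOn_univ.2 e.bijective).prodMap (Set.bijOn_id s))

namespace PadicInt

variable {p : ℕ} [hp : Fact p.Prime]

/-- A quantitative form of Hensel's lemma for the equation `z ^ m = c` near `1`. -/
theorem exists_pow_eq_and_unique {m : ℕ} {c : ℤ_[p]} (hc : ‖c - 1‖ < ‖(m : ℤ_[p])‖ ^ 2) :
    ∃ z : ℤ_[p], z ^ m = c ∧ ‖z - 1‖ < ‖(m : ℤ_[p])‖ ∧
      ∀ z' : ℤ_[p], z' ^ m = c → ‖z' - 1‖ < ‖(m : ℤ_[p])‖ → z' = z := by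
  let F : Polynomial ℤ_[p] := Polynomial.X ^ m - Polynomial.C c
  have hF : ∀ z, F.aeval z = z ^ m - c := fun z => by simp [F]
  have hF' : F.derivative.aeval (1 : ℤ_[p]) = m := by simp [F, Polynomial.derivative_X_pow]
  obtain ⟨z, hz, hz1, -, huniq⟩ := hensels_lemma (F := F) (a := (1 : ℤ_[p]))
    (by rwa [hF, hF', one_pow, norm_sub_rev])
  simp only [hF, hF', sub_eq_zero] at hz hz1 huniq
  exact ⟨z, hz, hz1, huniq⟩

variable (p) in
/-- The subgroup `1 + p ^ k ℤ_p`, as a set. -/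
def principalUnits (k : ℕ) : Set ℤ_[p] := {u | (p : ℤ_[p]) ^ k ∣ u - 1}

variable (p) in
/-- The nonzero `p`-adic integers whose angular component modulo `p ^ k` is `1`. -/
def angularOne (k : ℕ) : Set ℤ_[p] := {x | ∃ n : ℕ, ∃ u ∈ principalUnits p k, x = p ^ n * u}

variable (p) in
/-- Natural number representatives of the units modulo `p ^ k`. -/
abbrev UnitResidue (k : ℕ) : Type := {a : Fin (p ^ k) // ¬ p ∣ (a : ℕ)}

theorem pow_dvd_iff_norm_le {x : ℤ_[p]} {n : ℕ} : (p : ℤ_[p]) ^ n ∣ x ↔ ‖x‖ ≤ (p : ℝ) ^ (-n : ℤ) := by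
  rw [norm_le_pow_iff_mem_span_pow, Ideal.mem_span_singleton]

theorem isUnit_of_mem_principalUnits {k : ℕ} (hk : k ≠ 0) {u : ℤ_[p]}
    (hu : u ∈ principalUnits p k) : IsUnit u := by
  by_contra h
  rw [not_isUnit_iff, norm_lt_one_iff_dvd] at h
  have h1 : (p : ℤ_[p]) ∣ 1 := by
    simpa using dvd_sub h ((dvd_pow_self _ hk).trans hu)
  exact prime_p.not_isUnit (isUnit_of_dvd_one h1)

theorem mul_mem_principalUnits {k : ℕ} {u v : ℤ_[p]} (hu : u ∈ principalUnits p k)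
    (hv : v ∈ principalUnits p k) : u * v ∈ principalUnits p k := by
  have : u * v - 1 = (u - 1) * v + (v - 1) := by ring
  rw [principalUnits, Set.mem_ofPred_eq, this]
  exact dvd_add (hu.mul_right v) hv

theorem pow_mem_principalUnits {k : ℕ} {u : ℤ_[p]} (hu : u ∈ principalUnits p k) (m : ℕ) :
    u ^ m ∈ principalUnits p k :=
  hu.trans (sub_one_dvd_pow_sub_one u m)

theorem pow_totient_mem_principalUnits {w : ℤ_[p]} (hw : IsUnit w) (k : ℕ) :
    w ^ (p ^ k).totient ∈ principalUnits p k := by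
  rw [principalUnits, Set.mem_ofPred_eq, ← Ideal.mem_span_singleton, ← ker_toZModPow,
    RingHom.mem_ker, map_sub, map_one, map_pow, sub_eq_zero]
  obtain ⟨w', hw'⟩ := hw.map (toZModPow k : ℤ_[p] →+* ZMod (p ^ k))
  rw [← hw', ← Units.val_pow_eq_pow_val, ZMod.pow_totient, Units.val_one]

theorem isUnit_natCast_iff {a : ℕ} : IsUnit (a : ℤ_[p]) ↔ ¬ p ∣ a := by
  rw [isUnit_iff, norm_natCast_eq_one_iff, hp.out.coprime_iff_not_dvd]

theorem exists_eq_pow_mul_unitResidue {k : ℕ} (hk : k ≠ 0) {x : ℤ_[p]} (hx : x ≠ 0) :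
    ∃ n : ℕ, ∃ a : UnitResidue p k, ∃ u ∈ principalUnits p k,
      x = p ^ n * (a.1 : ℕ) * u := by
  set w := unitCoeff hx
  have happr : (p : ℤ_[p]) ^ k ∣ w - (appr (w : ℤ_[p]) k : ℕ) :=
    Ideal.mem_span_singleton.1 (appr_spec k _)
  have ha : IsUnit ((appr (w : ℤ_[p]) k : ℕ) : ℤ_[p]) := by
    by_contra h
    rw [not_isUnit_iff, norm_lt_one_iff_dvd] at h
    have : (p : ℤ_[p]) ∣ w := by simpa using dvd_add ((dvd_pow_self _ hk).trans happr) h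
    exact prime_p.not_isUnit (isUnit_of_dvd_unit this w.isUnit)
  refine ⟨x.valuation, ⟨⟨_, appr_lt (w : ℤ_[p]) k⟩, isUnit_natCast_iff.1 ha⟩, ?_⟩
  obtain ⟨a, haw⟩ := ha
  refine ⟨↑a⁻¹ * w, ?_, ?_⟩
  · have : (↑a⁻¹ * w - 1 : ℤ_[p]) = ↑a⁻¹ * (w - a) := by simp [mul_sub]
    rw [principalUnits, Set.mem_ofPred_eq, this, haw]
    exact happr.mul_left _
  · change x = p ^ x.valuation * ((appr (w : ℤ_[p]) k : ℕ) : ℤ_[p]) * (↑a⁻¹ * w)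
    rw [← haw, mul_assoc, Units.mul_inv_cancel_left, mul_comm]
    exact unitCoeff_spec hx

theorem pow_mul_unitResidue_injective {k : ℕ} (hk : k ≠ 0) {n n' : ℕ} {a a' : UnitResidue p k}
    {u u' : ℤ_[p]} (hu : u ∈ principalUnits p k) (hu' : u' ∈ principalUnits p k)
    (h : (p : ℤ_[p]) ^ n * (a.1 : ℕ) * u = p ^ n' * (a'.1 : ℕ) * u') :
    n = n' ∧ a = a' ∧ u = u' := by
  have ha := isUnit_natCast_iff.2 a.2
  have ha' := isUnit_natCast_iff.2 a'.2
  have hn : n = n' := by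
    have h1 := congrArg norm h
    rw [norm_mul, norm_mul, norm_mul, norm_mul, isUnit_iff.1 ha, isUnit_iff.1 ha',
      isUnit_iff.1 (isUnit_of_mem_principalUnits hk hu),
      isUnit_iff.1 (isUnit_of_mem_principalUnits hk hu'), norm_p_pow, norm_p_pow] at h1
    have h2 : (p : ℝ) ^ n = (p : ℝ) ^ n' := by simpa using h1
    exact Nat.pow_right_injective hp.out.two_le (mod_cast h2)
  subst hn
  rw [mul_assoc, mul_assoc] at h
  replace h := mul_left_cancel₀ (pow_ne_zero _ prime_p.ne_zero) h
  have haa : a = a' := by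
    have h1 : (p : ℤ_[p]) ^ k ∣ (((a.1 : ℕ) : ℤ) - ((a'.1 : ℕ) : ℤ) : ℤ) := by
      have : ((((a.1 : ℕ) : ℤ) - ((a'.1 : ℕ) : ℤ) : ℤ) : ℤ_[p]) =
          (a'.1 : ℕ) * (u' - 1) - (a.1 : ℕ) * (u - 1) := by
        push_cast
        linear_combination h
      rw [this]
      exact dvd_sub (hu'.mul_left _) (hu.mul_left _)
    rw [pow_p_dvd_int_iff] at h1
    have h2 : (a'.1 : ℕ) ≡ a.1 [MOD p ^ k] := Nat.modEq_iff_dvd.2 (by simpa using h1)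
    exact Subtype.ext (Fin.ext (h2.eq_of_lt_of_lt a'.1.2 a.1.2).symm)
  subst haa
  exact ⟨rfl, rfl, mul_left_cancel₀ ha.ne_zero h⟩

/-- If `u ↦ u ^ m` is a bijection from `1 + p ^ k ℤ_p` onto `1 + p ^ K ℤ_p`, then every nonzero
`p`-adic integer is uniquely of the form `p ^ i * a * s ^ m`. -/
theorem bijOn_pow_mul_unitResidue_mul_pow {m k K : ℕ} (hm : m ≠ 0) (hk : k ≠ 0) (hK : K ≠ 0)
    (h : Set.BijOn (· ^ m) (principalUnits p k) (principalUnits p K)) :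
    Set.BijOn (fun q : (Fin m × UnitResidue p K) × ℤ_[p] =>
        ((p ^ (q.1.1 : ℕ) * (q.1.2.1 : ℕ) : ℕ) : ℤ_[p]) * q.2 ^ m)
      (Set.univ ×ˢ angularOne p k) {x | x ≠ 0} := by
  have hexp : ∀ (i n a : ℕ) (u : ℤ_[p]), ((p ^ i * a : ℕ) : ℤ_[p]) * (p ^ n * u) ^ m =
      p ^ (i + m * n) * a * u ^ m := fun i n a u => by push_cast; ring
  refine ⟨?_, ?_, ?_⟩
  · rintro ⟨⟨i, a⟩, _⟩ ⟨-, n, u, hu, rfl⟩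
    simp only [hexp]
    exact mul_ne_zero (mul_ne_zero (pow_ne_zero _ prime_p.ne_zero)
      (isUnit_natCast_iff.2 a.2).ne_zero) (pow_ne_zero _ (isUnit_of_mem_principalUnits hk hu).ne_zero)
  · rintro ⟨⟨i, a⟩, _⟩ ⟨-, n, u, hu, rfl⟩ ⟨⟨i', a'⟩, _⟩ ⟨-, n', u', hu', rfl⟩ heq
    simp only [hexp] at heq
    obtain ⟨hn, rfl, huu⟩ := pow_mul_unitResidue_injective hK (h.mapsTo hu) (h.mapsTo hu') heq
    obtain rfl := h.injOn hu hu' huu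
    have hi : (i : ℕ) = i' := by
      simpa [Nat.add_mul_mod_self_left, Nat.mod_eq_of_lt] using congrArg (· % m) hn
    obtain rfl := Fin.ext hi
    obtain rfl : n = n' := by simpa [hm] using hn
    rfl
  · intro x hx
    obtain ⟨N, a, c, hc, rfl⟩ := exists_eq_pow_mul_unitResidue hK hx
    obtain ⟨u, hu, rfl⟩ := h.surjOn hc
    refine ⟨((⟨N % m, Nat.mod_lt _ (Nat.pos_of_ne_zero hm)⟩, a), p ^ (N / m) * u),
      ⟨trivial, N / m, u, hu, rfl⟩, ?_⟩
    simp only [hexp, Nat.mod_add_div]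


theorem bijOn_pow_principalUnits {m k K : ℕ}
    (hk : ∀ x : ℤ_[p], (p : ℤ_[p]) ^ k ∣ x ↔ ‖x‖ < ‖(m : ℤ_[p])‖)
    (hK : ∀ x : ℤ_[p], (p : ℤ_[p]) ^ K ∣ x → ‖x‖ < ‖(m : ℤ_[p])‖ ^ 2)
    (hmaps : ∀ u ∈ principalUnits p k, u ^ m ∈ principalUnits p K) :
    Set.BijOn (· ^ m) (principalUnits p k) (principalUnits p K) := by
  refine ⟨hmaps, fun u hu v hv huv => ?_, fun c hc => ?_⟩
  · obtain ⟨z, -, -, hz⟩ := exists_pow_eq_and_unique (hK _ (hmaps u hu))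
    rw [hz u rfl ((hk _).1 hu), hz v huv.symm ((hk _).1 hv)]
  · obtain ⟨z, hz, hz1, -⟩ := exists_pow_eq_and_unique (hK _ hc)
    exact ⟨z, (hk _).2 hz1, hz⟩

theorem bijOn_pow_principalUnits_one {m : ℕ} (hm : ¬ p ∣ m) :
    Set.BijOn (· ^ m) (principalUnits p 1) (principalUnits p 1) := by
  have h1 : ‖(m : ℤ_[p])‖ = 1 := isUnit_iff.1 (isUnit_natCast_iff.2 hm)
  refine bijOn_pow_principalUnits ?_ ?_ fun u hu => pow_mem_principalUnits hu m
  · simp [h1, norm_lt_one_iff_dvd]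
  · simp [h1, norm_lt_one_iff_dvd]

theorem bijOn_sq_principalUnits_two :
    Set.BijOn (· ^ 2) (principalUnits 2 2) (principalUnits 2 3) := by
  have h2 : ‖((2 : ℕ) : ℤ_[2])‖ = 2⁻¹ := by simpa using norm_p (p := 2)
  refine bijOn_pow_principalUnits (fun x => ?_) (fun x hx => ?_) ?_
  · rw [pow_dvd_iff_norm_le, norm_le_pow_iff_norm_lt_pow_add_one, h2]
    norm_num
  · rw [pow_dvd_iff_norm_le] at hx
    rw [h2]
    norm_num at hx ⊢
    linarith
  · rintro u ⟨c, hc⟩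
    refine ⟨c * (1 + 2 * c), ?_⟩
    push_cast at hc ⊢
    linear_combination (u + 1 + 4 * c) * hc

theorem bijOn_cube_principalUnits_two :
    Set.BijOn (· ^ 3) (principalUnits 2 2) (principalUnits 2 2) := by
  have h := bijOn_pow_principalUnits_one (p := 2) (m := 3) (by decide)
  have hle : principalUnits 2 2 ⊆ principalUnits 2 1 := fun u hu => (pow_dvd_pow _ one_le_two).trans hu
  refine ⟨fun u hu => pow_mem_principalUnits hu 3, h.injOn.mono hle, fun c hc => ?_⟩
  obtain ⟨u, hu, rfl⟩ := h.surjOn (hle hc)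
  refine ⟨u, ?_, rfl⟩
  obtain ⟨e, he⟩ := hu
  have hunit : IsUnit (u ^ 2 + u + 1) :=
    isUnit_of_mem_principalUnits one_ne_zero (p := 2)
      ⟨(1 + e) * (1 + 2 * e), by
        push_cast at he ⊢; linear_combination (u + 2 + 2 * e) * he⟩
  refine hunit.dvd_mul_right.1 ?_
  have h3 : (u - 1) * (u ^ 2 + u + 1) = u ^ 3 - 1 := by ring
  rw [h3]
  exact hc

end PadicInt

section PadicDefinability

open Set PadicInt

variable {p : ℕ} [hp : Fact p.Prime]

theorem Padic.norm_le_one_iff_exists_pow_eq {x : ℚ_[p]} :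
    ‖x‖ ≤ 1 ↔ ∃ y : ℚ_[p], 1 + p * x ^ (p + 1) = y ^ (p + 1) := by
  constructor
  · intro hx
    obtain ⟨x, rfl⟩ : ∃ z : ℤ_[p], (z : ℚ_[p]) = x := ⟨⟨x, hx⟩, rfl⟩
    have hm : ‖((p + 1 : ℕ) : ℤ_[p])‖ = 1 :=
      norm_natCast_eq_one_iff.2 (by simp)
    obtain ⟨y, hy, -⟩ := exists_pow_eq_and_unique (m := p + 1) (c := 1 + (p : ℤ_[p]) * x ^ (p + 1))
      (by rw [hm, one_pow, add_sub_cancel_left, norm_lt_one_iff_dvd]; exact dvd_mul_right _ _)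
    refine ⟨y, ?_⟩
    simpa using congrArg (fun z : ℤ_[p] => (z : ℚ_[p])) hy.symm
  · rintro ⟨y, hy⟩
    by_contra! hx
    have hp1 : (1 : ℝ) < p := mod_cast hp.out.one_lt
    have hx0 : x ≠ 0 := by rintro rfl; simp at hx; linarith
    have hv : x.valuation < 0 := by
      rw [Padic.norm_eq_zpow_neg_valuation hx0, one_lt_zpow_iff_right₀ hp1] at hx
      omega
    have hnorm : ‖(p : ℚ_[p]) * x ^ (p + 1)‖ = (p : ℝ) ^ (-1 - (p + 1) * x.valuation) := by
      rw [norm_mul, norm_pow, Padic.norm_p, Padic.norm_eq_zpow_neg_valuation hx0,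
        ← zpow_natCast, ← zpow_mul, ← zpow_neg_one, ← zpow_add₀ (by positivity)]
      congr 1
      push_cast
      ring
    have hgt : 1 < ‖(p : ℚ_[p]) * x ^ (p + 1)‖ := by
      rw [hnorm, one_lt_zpow_iff_right₀ hp1]
      have : (1 : ℤ) ≤ p := mod_cast hp.out.pos
      nlinarith
    have heq : ‖y ^ (p + 1)‖ = ‖(p : ℚ_[p]) * x ^ (p + 1)‖ := by
      rw [← hy, Padic.add_eq_max_of_ne (by rw [norm_one]; exact hgt.ne), norm_one,
        max_eq_right hgt.le]
    have hy0 : y ≠ 0 := by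
      rintro rfl
      rw [zero_pow (by simp), norm_zero] at heq
      linarith
    rw [hnorm, norm_pow, Padic.norm_eq_zpow_neg_valuation hy0, ← zpow_natCast, ← zpow_mul] at heq
    have h := zpow_right_injective₀ (by positivity) hp1.ne' heq
    push_cast at h
    have hdvd : ((p + 1 : ℤ)) ∣ 1 := ⟨y.valuation - x.valuation, by linear_combination h⟩
    have := Int.le_of_dvd one_pos hdvd
    have := hp.out.two_le
    omega

theorem Padic.definable_norm_le_one :
    (∅ : Set ℚ_[p]).Definable₁ Language.ring {x | ‖x‖ ≤ 1} := by
  have h := Definable.exists_of_finite (definable_freeCommRing_lift_eq (R := ℚ_[p])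
    (1 + p * .of (.inl 0) ^ (p + 1) : FreeCommRing (Fin 1 ⊕ Fin 1)) (.of (.inr 0) ^ (p + 1)))
  rw [Definable₁]
  convert h using 1
  ext v
  simp only [mem_ofPred_eq, norm_le_one_iff_exists_pow_eq, map_add, map_one, map_mul, map_natCast,
    map_pow, FreeCommRing.lift_of, Sum.elim_inl, Sum.elim_inr]
  exact ⟨fun ⟨y, hy⟩ => ⟨fun _ => y, hy⟩, fun ⟨y, hy⟩ => ⟨y 0, hy⟩⟩

theorem PadicInt.mem_angularOne_iff {k : ℕ} {x : ℤ_[p]} :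
    x ∈ angularOne p k ↔ ∃ i : Fin (p ^ k).totient, ∃ w u : ℤ_[p], w ≠ 0 ∧
      x = p ^ (i : ℕ) * w ^ (p ^ k).totient * (1 + p ^ k * u) := by
  constructor
  · rintro ⟨n, v, ⟨u, hu⟩, rfl⟩
    have hpos : 0 < (p ^ k).totient := Nat.totient_pos.2 (pow_pos hp.out.pos k)
    refine ⟨⟨n % (p ^ k).totient, Nat.mod_lt _ hpos⟩, p ^ (n / (p ^ k).totient), u,
      pow_ne_zero _ prime_p.ne_zero, ?_⟩
    rw [← hu, add_sub_cancel, ← pow_mul, ← pow_add, mul_comm (n / _), Nat.mod_add_div]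
  · rintro ⟨i, w, u, hw, rfl⟩
    refine ⟨i + w.valuation * (p ^ k).totient, unitCoeff hw ^ (p ^ k).totient * (1 + p ^ k * u),
      mul_mem_principalUnits (pow_totient_mem_principalUnits (unitCoeff hw).isUnit k)
        ⟨u, by ring⟩, ?_⟩
    conv_lhs => rw [unitCoeff_spec hw]
    ring

theorem PadicInt.definable_angularOne (k : ℕ) :
    (∅ : Set ℚ_[p]).Definable₁ Language.ring ((fun x : ℤ_[p] => (x : ℚ_[p])) '' angularOne p k) := by
  have hball (j : Fin 2) := (Padic.definable_norm_le_one (p := p)).definable_apply_mem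
    (.inr j : Fin 1 ⊕ Fin 2)
  have hne : (∅ : Set ℚ_[p]).Definable Language.ring
      {v : Fin 1 ⊕ Fin 2 → ℚ_[p] | v (.inr 0) = 0}ᶜ := by
    simpa using (definable_freeCommRing_lift_eq (R := ℚ_[p]) (.of (.inr 0 : Fin 1 ⊕ Fin 2)) 0).compl
  have heq (i : ℕ) : (∅ : Set ℚ_[p]).Definable Language.ring
      {v : Fin 1 ⊕ Fin 2 → ℚ_[p] |
        v (.inl 0) = p ^ i * v (.inr 0) ^ (p ^ k).totient * (1 + p ^ k * v (.inr 1))} := by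
    simpa using definable_freeCommRing_lift_eq (R := ℚ_[p]) (.of (.inl 0 : Fin 1 ⊕ Fin 2))
      (p ^ i * .of (.inr 0) ^ (p ^ k).totient * (1 + p ^ k * .of (.inr 1)))
  have h := definable_iUnion_of_finite fun i : Fin (p ^ k).totient => Definable.exists_of_finite
    (((hball 0).inter (hball 1)).inter (hne.inter (heq i)))
  rw [Definable₁]
  convert h using 1
  ext v
  simp only [mem_iUnion, mem_image, mem_angularOne_iff, mem_ofPred_eq, mem_inter_iff, mem_compl_iff,
    Sum.elim_inl, Sum.elim_inr]
  constructor
  · rintro ⟨_, ⟨i, w, u, hw, rfl⟩, hv⟩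
    refine ⟨i, ![(w : ℚ_[p]), u], ⟨w.2, u.2⟩, ?_, ?_⟩
    · simpa using hw
    · simp [← hv]
  · rintro ⟨i, t, ⟨ht0, ht1⟩, hne, hv⟩
    obtain ⟨w, hw⟩ : ∃ w : ℤ_[p], (w : ℚ_[p]) = t 0 := ⟨⟨_, ht0⟩, rfl⟩
    obtain ⟨u, hu⟩ : ∃ u : ℤ_[p], (u : ℚ_[p]) = t 1 := ⟨⟨_, ht1⟩, rfl⟩
    refine ⟨_, ⟨i, w, u, ?_, rfl⟩, by simp [hv, hw, hu]⟩
    rintro rfl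
    exact hne (by simpa using hw.symm)

theorem PadicInt.image_coe_ne_zero :
    (fun x : ℤ_[p] => (x : ℚ_[p])) '' {x | x ≠ 0} = {x : ℚ_[p] | ‖x‖ ≤ 1 ∧ x ≠ 0} := by
  ext x
  constructor
  · rintro ⟨x, h0, rfl⟩
    exact ⟨x.2, fun h => h0 (Subtype.ext h)⟩
  · rintro ⟨hx, h0⟩
    exact ⟨⟨x, hx⟩, fun h => h0 (congrArg Subtype.val h), rfl⟩

theorem PadicInt.image_tag_coe_ne_zero :
    (fun q : Fin 2 × ℤ_[p] => (((q.1 : ℕ) : ℚ_[p]), (q.2 : ℚ_[p]))) '' (univ ×ˢ {x | x ≠ 0}) =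
      ({0} ×ˢ {x : ℚ_[p] | ‖x‖ ≤ 1 ∧ x ≠ 0}) ∪ ({1} ×ˢ {x : ℚ_[p] | ‖x‖ ≤ 1 ∧ x ≠ 0}) := by
  rw [← image_coe_ne_zero]
  ext ⟨t, x⟩
  constructor
  · rintro ⟨⟨i, z⟩, ⟨-, hz⟩, h⟩
    obtain ⟨rfl, rfl⟩ := Prod.mk.inj h
    fin_cases i
    · exact Or.inl ⟨by simp, z, hz, rfl⟩
    · exact Or.inr ⟨by simp, z, hz, rfl⟩
  · rintro (⟨ht, z, hz, hx⟩ | ⟨ht, z, hz, hx⟩)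
    · exact ⟨(0, z), ⟨trivial, hz⟩, Prod.ext (by simpa using ht.symm) hx⟩
    · exact ⟨(1, z), ⟨trivial, hz⟩, Prod.ext (by simpa using ht.symm) hx⟩

theorem PadicInt.bijOn_sigma_unitResidue {k : ℕ} {m : Fin 2 → ℕ} (hk : k ≠ 0) (hm : ∀ t, m t ≠ 0)
    (hmb : ∀ t, BijOn (· ^ m t) (principalUnits p k) (principalUnits p k)) :
    BijOn (fun q : (Σ t : Fin 2, Fin (m t) × UnitResidue p k) × ℤ_[p] =>
    (q.1.1, ((p ^ (q.1.2.1 : ℕ) * (q.1.2.2.1 : ℕ) : ℕ) : ℤ_[p]) * q.2 ^ m q.1.1))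
    (univ ×ˢ angularOne p k) (univ ×ˢ {x | x ≠ 0}) := by
  exact Set.BijOn.sigma_tag (ρ := fun t => Fin (m t) × UnitResidue p k)
    (g := fun t q => ((p ^ (q.1.1 : ℕ) * (q.1.2.1 : ℕ) : ℕ) : ℤ_[p]) * q.2 ^ m t)
    fun t => bijOn_pow_mul_unitResidue_mul_pow (hm t) hk hk (hmb t)

theorem exists_bijOn_definable_of_card {k K l : ℕ} {m : Fin 2 → ℕ} (hk : k ≠ 0) (hK : K ≠ 0)
    (hl : l ≠ 0) (hm : ∀ t, m t ≠ 0)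
    (hmb : ∀ t, BijOn (· ^ m t) (principalUnits p k) (principalUnits p k))
    (hlb : BijOn (· ^ l) (principalUnits p k) (principalUnits p K))
    (hcard : (m 0 + m 1) * Nat.card (UnitResidue p k) = l * Nat.card (UnitResidue p K)) :
    ∃ f : ℚ_[p] × ℚ_[p] → ℚ_[p],
      BijOn f (({0} ×ˢ {x : ℚ_[p] | ‖x‖ ≤ 1 ∧ x ≠ 0}) ∪ ({1} ×ˢ {x : ℚ_[p] | ‖x‖ ≤ 1 ∧ x ≠ 0}))
        {x : ℚ_[p] | ‖x‖ ≤ 1 ∧ x ≠ 0} ∧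
      (∅ : Set ℚ_[p]).Definable Language.ring
        {v : Fin 3 → ℚ_[p] |
          (v 0, v 1) ∈ ({0} ×ˢ {x : ℚ_[p] | ‖x‖ ≤ 1 ∧ x ≠ 0}) ∪
              ({1} ×ˢ {x : ℚ_[p] | ‖x‖ ≤ 1 ∧ x ≠ 0}) ∧
            f (v 0, v 1) = v 2} := by
  obtain ⟨e⟩ : Nonempty ((Σ t : Fin 2, Fin (m t) × UnitResidue p k) ≃ Fin l × UnitResidue p K) := by
    rw [← Finite.card_eq, Nat.card_sigma, Fin.sum_univ_two, Nat.card_prod, Nat.card_prod,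
      Nat.card_prod, Nat.card_fin, Nat.card_fin, Nat.card_fin, ← hcard, add_mul]
  have hcoe : Function.Injective fun x : ℤ_[p] => (x : ℚ_[p]) := Subtype.val_injective
  have hEbij : BijOn (fun q : (Σ t : Fin 2, Fin (m t) × UnitResidue p k) × ℤ_[p] =>
      ((p ^ ((e q.1).1 : ℕ) * ((e q.1).2.1 : ℕ) : ℕ) : ℤ_[p]) * q.2 ^ l)
      (univ ×ˢ angularOne p k) {x | x ≠ 0} :=
    Set.BijOn.comp_equiv_fst (g := fun q : (Fin l × UnitResidue p K) × ℤ_[p] =>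
      ((p ^ (q.1.1 : ℕ) * (q.1.2.1 : ℕ) : ℕ) : ℤ_[p]) * q.2 ^ l)
      (bijOn_pow_mul_unitResidue_mul_pow hl hk hK hlb) e
  rw [← image_tag_coe_ne_zero, ← image_coe_ne_zero]
  refine exists_bijOn_definable_of_monomial (definable_angularOne k)
    (fun r : Σ t : Fin 2, Fin (m t) × UnitResidue p k => r.1)
    (fun r => p ^ (r.2.1 : ℕ) * (r.2.2.1 : ℕ))
    (fun r => p ^ ((e r).1 : ℕ) * ((e r).2.1 : ℕ)) (fun r => m r.1) (fun _ => l) ?_ ?_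
  · rw [← image_id (univ : Set (Σ t : Fin 2, Fin (m t) × UnitResidue p k)), prod_image_image_eq]
    refine (bijOn_sigma_unitResidue hk hm hmb).image_of_semiconj ?_ ?_
    · rintro ⟨t, x⟩ - ⟨t', x'⟩ - h
      obtain ⟨h1, h2⟩ := Prod.mk.inj h
      exact Prod.ext (Fin.ext (mod_cast h1)) (hcoe h2)
    · rintro ⟨r, s⟩ -
      simp
  · rw [← image_id (univ : Set (Σ t : Fin 2, Fin (m t) × UnitResidue p k)), prod_image_image_eq]
    refine hEbij.image_of_semiconj hcoe.injOn ?_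
    rintro ⟨r, s⟩ -
    simp

end PadicDefinability

theorem exists_definable_bij_disjoint_union_Rstar (p : ℕ) [Fact p.Prime] :
    ∃ f : ℚ_[p] × ℚ_[p] → ℚ_[p],
      Set.BijOn f
        (({0} ×ˢ {x : ℚ_[p] | ‖x‖ ≤ 1 ∧ x ≠ 0}) ∪
          ({1} ×ˢ {x : ℚ_[p] | ‖x‖ ≤ 1 ∧ x ≠ 0}))
        {x : ℚ_[p] | ‖x‖ ≤ 1 ∧ x ≠ 0} ∧
      Set.Definable (∅ : Set ℚ_[p]) Language.ring
        {v : Fin 3 → ℚ_[p] |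
          (v 0, v 1) ∈ ({0} ×ˢ {x : ℚ_[p] | ‖x‖ ≤ 1 ∧ x ≠ 0}) ∪
              ({1} ×ˢ {x : ℚ_[p] | ‖x‖ ≤ 1 ∧ x ≠ 0}) ∧
            f (v 0, v 1) = v 2} := by
  have hone (k : ℕ) :
      Set.BijOn (· ^ 1) (PadicInt.principalUnits p k) (PadicInt.principalUnits p k) := by
    simpa using! Set.bijOn_id (PadicInt.principalUnits p k)
  obtain rfl | hp2 := eq_or_ne p 2
  · refine exists_bijOn_definable_of_card (k := 2) (K := 3) (l := 2) (m := ![3, 1])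
      two_ne_zero three_ne_zero two_ne_zero (by decide) ?_ PadicInt.bijOn_sq_principalUnits_two ?_
    · rw [Fin.forall_fin_two]
      exact ⟨PadicInt.bijOn_cube_principalUnits_two, hone 2⟩
    · simp only [Nat.card_eq_fintype_card]
      decide
  · refine exists_bijOn_definable_of_card (k := 1) (K := 1) (l := 2) (m := ![1, 1])
      one_ne_zero one_ne_zero two_ne_zero (by decide) ?_ (PadicInt.bijOn_pow_principalUnits_one ?_) rfl
    · rw [Fin.forall_fin_two]
      exact ⟨hone 1, hone 1⟩
    · rwa [Nat.prime_dvd_prime_iff_eq Fact.out Nat.prime_two]
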